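/- Let σ : ℝ → ℝ be Lipschitz continuous and not equal to any polynomial, let Ω ⊂ ℝⁿ be a compact set, let f : Ω → ℝⁿ be continuous, and let ε > 0. Then there exist N ∈ ℕ, a step size h > 0, weights J_j ∈ ℝ^{2n×2n} skew-symmetric, W_j ∈ ℝ^{2n×2n}, b_j ∈ ℝ^{2n}, η_j ∈ ℝ^{2n} for j = 0,…,N−1, and a map Q : Ω → ℝⁿ such that for every ξ ∈ Ω there is an HDNN trajectory (p_j, q_j)_{j=0}^{N} with these weights, initial condition (p_0, q_0) = (ξ, 0ₙ), and q_N = Q(ξ), and such that sup_{ξ ∈ Ω} ‖f(ξ) − Q(ξ)‖ ≤ ε (UAP of the restricted flow ξ ↦ q_N of the HDNN). -/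

import Mathlib

open Matrix

/-- Euclidean norm of a finitely-indexed real vector. -/
noncomputable def euclNorm {m : Type*} [Fintype m] (v : m → ℝ) : ℝ :=
  Real.sqrt (∑ i, v i ^ 2)

/-- Entrywise application of a scalar function to a vector. -/
def entApp {m : Type*} (σ : ℝ → ℝ) (v : m → ℝ) : m → ℝ := fun i => σ (v i)

/-- `(p_j, q_j)_{j=0}^{N}` is an HDNN trajectory (semi-implicit Euler recursion)
with step size `h`, activation `σ`, and weights `J_j, W_j, b_j, η_j`:
`(p_{j+1}; q_{j+1}) = (p_j; q_j) + h • J_j (W_jᵀ σ(W_j (p_{j+1}; q_j) + b_j) + η_j)`. -/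
def IsHDNNTraj (n N : ℕ) (h : ℝ) (σ : ℝ → ℝ)
    (J W : ℕ → Matrix (Fin n ⊕ Fin n) (Fin n ⊕ Fin n) ℝ)
    (b η : ℕ → ((Fin n ⊕ Fin n) → ℝ))
    (p q : ℕ → (Fin n → ℝ)) : Prop :=
  ∀ j < N,
    Sum.elim (p (j + 1)) (q (j + 1)) =
      Sum.elim (p j) (q j) +
        h • (J j).mulVec
          ((W j)ᵀ.mulVec (entApp σ ((W j).mulVec (Sum.elim (p (j + 1)) (q j)) + b j)) + η j)

open Filter Topology MeasureTheory
open scoped ContDiff Convolution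

theorem exists_sum_pow_of_iteratedDeriv_eq_zero (k : ℕ) :
    ∀ f : ℝ → ℝ, ContDiff ℝ ∞ f → (∀ x, iteratedDeriv k f x = 0) →
      ∃ c : ℕ → ℝ, ∀ x, f x = ∑ i ∈ Finset.range k, c i * x ^ i := by
  induction k with
  | zero =>
    intro f _ h
    exact ⟨0, fun x => by simpa using h x⟩
  | succ k ih =>
    intro f hf h
    obtain ⟨c, hc⟩ := ih (deriv f) (contDiff_infty_iff_deriv.1 hf).2 fun x => by
      rw [← iteratedDeriv_succ']; exact h x
    have hfd : Differentiable ℝ f := (contDiff_infty_iff_deriv.1 hf).1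
    have hp : ∀ x : ℝ, HasDerivAt
        (fun x => ∑ i ∈ Finset.range k, c i / (i + 1 : ℝ) * x ^ (i + 1))
        (∑ i ∈ Finset.range k, c i * x ^ i) x := fun x => by
      refine HasDerivAt.fun_sum fun i _ => ?_
      convert! (hasDerivAt_pow (i + 1) x).const_mul (c i / (i + 1 : ℝ)) using 1
      have : (i + 1 : ℝ) ≠ 0 := by positivity
      rw [Nat.add_sub_cancel]
      push_cast
      field_simp
    have hd : ∀ x, HasDerivAt
        (fun x => f x - ∑ i ∈ Finset.range k, c i / (i + 1 : ℝ) * x ^ (i + 1)) 0 x := fun x => by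
      convert! (hfd x).hasDerivAt.sub (hp x) using 1
      rw [hc x, sub_self]
    refine ⟨fun i => if i = 0 then f 0 else c (i - 1) / (i : ℝ), fun x => ?_⟩
    have hx := is_const_of_deriv_eq_zero (fun x => (hd x).differentiableAt)
      (fun x => (hd x).deriv) x 0
    rw [Finset.sum_range_succ']
    simp only [ne_eq, Nat.add_eq_zero_iff, one_ne_zero, and_false, not_false_eq_true, zero_pow,
      mul_zero, Finset.sum_const_zero, sub_zero, if_false, Nat.add_sub_cancel, if_true, pow_zero,
      mul_one] at hx ⊢
    push_cast
    linarith

theorem exists_polynomial_of_tendsto {ι : Type*} {l : Filter ι} [l.NeBot] {F : ι → ℝ → ℝ}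
    {σ : ℝ → ℝ} (k : ℕ) (c : ι → ℕ → ℝ)
    (hF : ∀ i x, F i x = ∑ j ∈ Finset.range k, c i j * x ^ j)
    (hlim : ∀ x, Tendsto (fun i => F i x) l (𝓝 (σ x))) :
    ∃ P : Polynomial ℝ, ∀ x, σ x = P.eval x := by
  classical
  have hinj : Set.InjOn (fun j : ℕ => (j : ℝ)) (Finset.range k : Set ℕ) :=
    Nat.cast_injective.injOn
  refine ⟨Lagrange.interpolate (Finset.range k) (fun j : ℕ => (j : ℝ)) fun j => σ j, fun x => ?_⟩
  refine tendsto_nhds_unique (hlim x) ?_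
  have key : ∀ i, F i x = ∑ j ∈ Finset.range k,
      F i j * (Lagrange.basis (Finset.range k) (fun j : ℕ => (j : ℝ)) j).eval x := fun i => by
    set p : Polynomial ℝ := ∑ j ∈ Finset.range k, Polynomial.C (c i j) * Polynomial.X ^ j with hp
    have hev : ∀ y, p.eval y = F i y := fun y => by
      rw [hF, hp, Polynomial.eval_finsetSum]; simp
    have hdeg : p.degree < (Finset.range k).card := by
      rw [Finset.card_range, hp, Finset.sum_range]
      exact Polynomial.degree_sum_fin_lt fun j : Fin k => c i j
    have := congrArg (Polynomial.eval x) (Lagrange.eq_interpolate_of_eval_eq (fun j : ℕ => F i j)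
      hinj hdeg fun j _ => hev j)
    rw [hev] at this
    rw [this, Lagrange.interpolate_apply, Polynomial.eval_finsetSum]
    simp
  simp only [key, Lagrange.interpolate_apply, Polynomial.eval_finsetSum, Polynomial.eval_mul,
    Polynomial.eval_C]
  exact tendsto_finsetSum _ fun j _ => (hlim j).mul_const _

/-- Any continuous non-polynomial function has a mollification whose `k`-th derivative does not
vanish identically. -/
theorem exists_bump_iteratedDeriv_ne_zero {σ : ℝ → ℝ} (hσ : Continuous σ)
    (hpoly : ¬ ∃ P : Polynomial ℝ, ∀ x, σ x = P.eval x) (k : ℕ) :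
    ∃ φ : ContDiffBump (0 : ℝ), ∃ b : ℝ,
      iteratedDeriv k (φ.normed volume ⋆[ContinuousLinearMap.lsmul ℝ ℝ, volume] σ) b ≠ 0 := by
  by_contra! H
  let φ : ℕ → ContDiffBump (0 : ℝ) := fun m =>
    ⟨1 / ((m : ℝ) + 1) / 2, 1 / ((m : ℝ) + 1), by positivity, half_lt_self (by positivity)⟩
  have hsm : ∀ m, ContDiff ℝ ∞
      ((φ m).normed volume ⋆[ContinuousLinearMap.lsmul ℝ ℝ, volume] σ) := fun m =>
    (φ m).hasCompactSupport_normed.contDiff_convolution_left _ (φ m).contDiff_normed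
      hσ.locallyIntegrable
  choose c hc using fun m => exists_sum_pow_of_iteratedDeriv_eq_zero k _ (hsm m) (H (φ m))
  exact hpoly (exists_polynomial_of_tendsto k c hc fun x =>
    ContDiffBump.convolution_tendsto_right_of_continuous
      tendsto_one_div_add_atTop_nhds_zero_nat hσ x)

theorem integral_mem_of_isClosed {α E : Type*} [MeasurableSpace α] {μ : Measure α}
    [NormedAddCommGroup E] [NormedSpace ℝ E] [CompleteSpace E] {S : Submodule ℝ E}
    (hS : IsClosed (S : Set E)) {F : α → E} (hFi : Integrable F μ) (hF : ∀ a, F a ∈ S) :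
    ∫ a, F a ∂μ ∈ S := by
  have : IsClosed (S.toAddSubgroup : Set E) := hS
  have h := S.mkQL.integral_comp_comm hFi
  rw [← Submodule.Quotient.mk_eq_zero S]
  refine h.symm.trans (integral_eq_zero_of_ae (Eventually.of_forall fun a => ?_))
  exact (Submodule.Quotient.mk_eq_zero S).2 (hF a)

section Closed

variable {X : Type*} [TopologicalSpace X] [CompactSpace X]

/-- The function `x ↦ g (t * y x + b)`. -/
def ridge (g : C(ℝ, ℝ)) (y : C(X, ℝ)) (t b : ℝ) : C(X, ℝ) :=
  ⟨fun x => g (t * y x + b), by fun_prop⟩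

theorem convolution_ridge_mem {S : Submodule ℝ C(X, ℝ)} (hS : IsClosed (S : Set C(X, ℝ)))
    {σ : C(ℝ, ℝ)} {y : C(X, ℝ)} (hσ : ∀ t b, ridge σ y t b ∈ S) {φ : ℝ → ℝ} (hφ : Continuous φ)
    (hφc : HasCompactSupport φ) {g : C(ℝ, ℝ)}
    (hg : ⇑g = φ ⋆[ContinuousLinearMap.lsmul ℝ ℝ, volume] σ) (t b : ℝ) :
    ridge g y t b ∈ S := by
  let F : ℝ → C(X, ℝ) := fun s => φ s • ridge σ y t (b - s)
  have hF : Continuous F := hφ.smul <|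
    ContinuousMap.continuous_of_continuous_uncurry (fun s => ridge σ y t (b - s)) (by
      change Continuous fun p : ℝ × X => σ (t * y p.2 + (b - p.1))
      fun_prop)
  have hFi : Integrable F := hF.integrable_of_hasCompactSupport hφc.smul_right
  have hval : ridge g y t b = ∫ s, F s := by
    ext x
    rw [ContinuousMap.integral_apply hFi]
    change g (t * y x + b) = ∫ s, φ s * σ (t * y x + (b - s))
    rw [hg, convolution_lsmul]
    simp only [smul_eq_mul, add_sub_assoc]
  rw [hval]
  exact integral_mem_of_isClosed hS hFi fun s => S.smul_mem _ (hσ _ _)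

theorem mem_of_hasDerivAt {E : Type*} [NormedAddCommGroup E] [NormedSpace ℝ E] {S : Submodule ℝ E}
    (hS : IsClosed (S : Set E)) {F : ℝ → E} (hF : ∀ t, F t ∈ S) {F' : E} {t : ℝ}
    (h : HasDerivAt F F' t) : F' ∈ S := by
  refine hS.mem_of_tendsto (hasDerivAt_iff_tendsto_slope.1 h) (Eventually.of_forall fun s => ?_)
  exact S.smul_mem _ (S.sub_mem (hF _) (hF _))

theorem pow_mul_iteratedDeriv_ridge_mem {S : Submodule ℝ C(X, ℝ)}
    (hS : IsClosed (S : Set C(X, ℝ))) {g : ℝ → ℝ} (hg : ContDiff ℝ ∞ g) {y : C(X, ℝ)}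
    (hgS : ∀ t b, ridge ⟨g, hg.continuous⟩ y t b ∈ S) (k : ℕ) :
    ∀ t b, y ^ k *
      ridge ⟨iteratedDeriv k g, hg.continuous_iteratedDeriv k (by exact_mod_cast le_top)⟩ y t b
        ∈ S := by
  have hc : ∀ k, Continuous (iteratedDeriv k g) := fun k =>
    hg.continuous_iteratedDeriv k (by exact_mod_cast le_top)
  induction k with
  | zero =>
    intro t b
    simpa using hgS t b
  | succ k ih =>
    intro t b
    let F : ℕ → ℝ → C(X, ℝ) := fun k t => y ^ k * ridge ⟨iteratedDeriv k g, hc k⟩ y t b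
    have hFc : ∀ k, Continuous (F k) := fun k =>
      ContinuousMap.continuous_of_continuous_uncurry _ (by
        have := hc k
        change Continuous fun p : ℝ × X => y p.2 ^ k * iteratedDeriv k g (p.1 * y p.2 + b)
        fun_prop)
    have hd : ∀ x t, HasDerivAt (fun t => F k t x) (F (k + 1) t x) t := fun x t => by
      have h1 : HasDerivAt (iteratedDeriv k g) (iteratedDeriv (k + 1) g (t * y x + b))
          (t * y x + b) := by
        rw [iteratedDeriv_succ]
        exact (hg.differentiable_iteratedDeriv k (by exact_mod_cast WithTop.coe_lt_top k)
          _).hasDerivAt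
      have h2 : HasDerivAt (fun t => t * y x + b) (y x) t := by
        simpa using ((hasDerivAt_id t).mul_const (y x)).add_const b
      convert! (h1.comp t h2).const_mul (y x ^ k) using 1
      change y x ^ (k + 1) * iteratedDeriv (k + 1) g (t * y x + b) = _
      ring
    have hint : ∀ t, F k t = F k 0 + ∫ s in (0 : ℝ)..t, F (k + 1) s := fun t => by
      ext x
      have hi := (hFc (k + 1)).intervalIntegrable (μ := volume) 0 t
      have := (ContinuousMap.evalCLM ℝ x).intervalIntegral_comp_comm hi
      change _ = F k 0 x + ContinuousMap.evalCLM ℝ x (∫ s in (0 : ℝ)..t, F (k + 1) s)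
      rw [← this]
      change _ = F k 0 x + ∫ s in (0 : ℝ)..t, F (k + 1) s x
      rw [intervalIntegral.integral_eq_sub_of_hasDerivAt (fun s _ => hd x s)
        (((ContinuousMap.evalCLM ℝ x).continuous.comp (hFc (k + 1))).intervalIntegrable 0 t)]
      ring
    refine mem_of_hasDerivAt hS (F := F k) (fun t => ih t b) (t := t) ?_
    rw [funext hint]
    exact ((hFc (k + 1)).integral_hasStrictDerivAt 0 t).hasDerivAt.const_add _

/-- A closed subspace containing all ridge functions `x ↦ σ (t * y x + b)`, with `σ` continuous
and not a polynomial, contains all powers of `y`. -/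
theorem pow_mem_of_ridge_mem {S : Submodule ℝ C(X, ℝ)} (hS : IsClosed (S : Set C(X, ℝ)))
    {σ : C(ℝ, ℝ)} (hpoly : ¬ ∃ P : Polynomial ℝ, ∀ x, σ x = P.eval x) {y : C(X, ℝ)}
    (hσ : ∀ t b, ridge σ y t b ∈ S) (k : ℕ) : y ^ k ∈ S := by
  obtain ⟨φ, b, hb⟩ := exists_bump_iteratedDeriv_ne_zero σ.continuous hpoly k
  set g := φ.normed volume ⋆[ContinuousLinearMap.lsmul ℝ ℝ, volume] σ with hg
  have hsm : ContDiff ℝ ∞ g :=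
    φ.hasCompactSupport_normed.contDiff_convolution_left _ φ.contDiff_normed
      σ.continuous.locallyIntegrable
  have h := pow_mul_iteratedDeriv_ridge_mem hS hsm (y := y) (convolution_ridge_mem hS hσ
    φ.continuous_normed φ.hasCompactSupport_normed rfl) k 0 b
  convert! S.smul_mem (iteratedDeriv k g b)⁻¹ h using 1
  ext x
  change y x ^ k = (iteratedDeriv k g b)⁻¹ * (y x ^ k * iteratedDeriv k g (0 * y x + b))
  rw [zero_mul, zero_add]
  field_simp

theorem exp_mem_of_pow_mem {S : Submodule ℝ C(X, ℝ)} (hS : IsClosed (S : Set C(X, ℝ)))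
    {y : C(X, ℝ)} (hy : ∀ k : ℕ, y ^ k ∈ S) : NormedSpace.exp y ∈ S := by
  refine hS.mem_of_tendsto (NormedSpace.exp_series_hasSum_exp' (𝕂 := ℝ) y)
    (Eventually.of_forall fun s => ?_)
  exact S.sum_mem fun k _ => S.smul_mem _ (hy k)

/-- A closed subspace containing the exponentials of a subgroup of functions that separates
points is everything. -/
theorem eq_top_of_exp_mem {S : Submodule ℝ C(X, ℝ)} (hS : IsClosed (S : Set C(X, ℝ)))
    (L : AddSubgroup C(X, ℝ)) (hL : ∀ y ∈ L, NormedSpace.exp y ∈ S)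
    (hsep : ∀ x x' : X, x ≠ x' → ∃ y ∈ L, y x ≠ y x') : S = ⊤ := by
  let M : Submonoid C(X, ℝ) :=
    { carrier := {z | ∃ y ∈ L, NormedSpace.exp y = z}
      one_mem' := ⟨0, L.zero_mem, NormedSpace.exp_zero⟩
      mul_mem' := by
        rintro _ _ ⟨y, hy, rfl⟩ ⟨z, hz, rfl⟩
        exact ⟨y + z, L.add_mem hy hz, NormedSpace.exp_add⟩ }
  have hA : Subalgebra.toSubmodule (Algebra.adjoin ℝ (M : Set C(X, ℝ))) ≤ S := by
    rw [Algebra.adjoin_eq_span, Submonoid.closure_eq, Submodule.span_le]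
    rintro _ ⟨y, hy, rfl⟩
    exact hL y hy
  have hsw := ContinuousMap.subalgebra_topologicalClosure_eq_top_of_separatesPoints
    (Algebra.adjoin ℝ (M : Set C(X, ℝ))) (by
      intro x x' hx
      obtain ⟨y, hy, hne⟩ := hsep x x' hx
      refine ⟨_, ⟨NormedSpace.exp y, Algebra.subset_adjoin ⟨y, hy, rfl⟩, rfl⟩, fun h => hne ?_⟩
      have hev : ∀ x, NormedSpace.exp y x = Real.exp (y x) := fun x => by
        have := NormedSpace.map_exp (ContinuousMap.evalAlgHom ℝ ℝ x)
          (ContinuousMap.evalCLM ℝ x).continuous y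
        rw [Real.exp_eq_exp_ℝ]
        exact this
      exact Real.exp_injective (((hev x).symm.trans h).trans (hev x')))
  rw [eq_top_iff]
  intro z _
  have hz : z ∈ closure ((Algebra.adjoin ℝ (M : Set C(X, ℝ)) : Subalgebra ℝ C(X, ℝ)) :
      Set C(X, ℝ)) := by
    rw [← Subalgebra.topologicalClosure_coe, hsw]
    trivial
  exact closure_minimal hA hS hz

end Closed

/-- The update `q ↦ q + u p`, with `p` kept fixed, is realised by one HDNN layer with unit
step size. -/
def IsLayer {n : ℕ} (σ : ℝ → ℝ) (u : (Fin n → ℝ) → (Fin n → ℝ)) : Prop :=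
  ∃ (J W : Matrix (Fin n ⊕ Fin n) (Fin n ⊕ Fin n) ℝ) (b η : (Fin n ⊕ Fin n) → ℝ), Jᵀ = -J ∧
    ∀ p q : Fin n → ℝ, Sum.elim p (q + u p) = Sum.elim p q +
      (1 : ℝ) • J.mulVec (Wᵀ.mulVec (entApp σ (W.mulVec (Sum.elim p q) + b)) + η)

section Layers

variable {n : ℕ}

theorem exists_skew_mulVec {w : Fin n → ℝ} (hw : w ≠ 0) (v : Fin n → ℝ) :
    ∃ J : Matrix (Fin n ⊕ Fin n) (Fin n ⊕ Fin n) ℝ, Jᵀ = -J ∧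
      J.mulVec (Sum.elim w 0) = Sum.elim (0 : Fin n → ℝ) v := by
  obtain ⟨i, hi⟩ := Function.ne_iff.1 hw
  have hi' : w i ≠ 0 := hi
  let B : Matrix (Fin n) (Fin n) ℝ := vecMulVec v (Pi.single i (w i)⁻¹)
  refine ⟨fromBlocks 0 (-Bᵀ) B 0, ?_, ?_⟩
  · rw [fromBlocks_transpose, fromBlocks_neg]
    simp
  · rw [fromBlocks_mulVec]
    have : B.mulVec w = v := by
      rw [vecMulVec_mulVec, single_dotProduct, inv_mul_cancel₀ hi']
      simp
    simp [this]

theorem isLayer_const [NeZero n] (σ : ℝ → ℝ) (v : Fin n → ℝ) : IsLayer σ fun _ => v := by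
  obtain ⟨J, hJ, hJv⟩ := exists_skew_mulVec (one_ne_zero : (1 : Fin n → ℝ) ≠ 0) v
  refine ⟨J, 0, 0, Sum.elim 1 0, hJ, fun p q => ?_⟩
  rw [transpose_zero, zero_mulVec, zero_add, one_smul, hJv]
  ext i
  rcases i with i | i <;> simp

theorem isLayer_ridge (σ : ℝ → ℝ) (w v : Fin n → ℝ) (b : ℝ) :
    IsLayer σ fun p => σ (w ⬝ᵥ p + b) • v := by
  rcases Nat.eq_zero_or_pos n with rfl | hn
  · refine ⟨0, 0, 0, 0, by simp, fun p q => ?_⟩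
    ext i
    rcases i with i | i <;> exact i.elim0
  have : NeZero n := ⟨hn.ne'⟩
  by_cases hw : w = 0
  · simpa [hw] using isLayer_const σ (σ b • v)
  obtain ⟨J, hJ, hJv⟩ := exists_skew_mulVec hw v
  refine ⟨J, vecMulVec (Pi.single (Sum.inl 0) 1) (Sum.elim w 0), fun _ => b, 0, hJ, fun p q => ?_⟩
  have hgrad : ((vecMulVec (Pi.single (Sum.inl 0) 1) (Sum.elim w 0) :
      Matrix (Fin n ⊕ Fin n) (Fin n ⊕ Fin n) ℝ))ᵀ.mulVec
      (entApp σ ((vecMulVec (Pi.single (Sum.inl 0) 1) (Sum.elim w 0)).mulVec (Sum.elim p q) +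
        fun _ => b)) = σ (w ⬝ᵥ p + b) • Sum.elim w 0 := by
    rw [transpose_vecMulVec, vecMulVec_mulVec, vecMulVec_mulVec, single_dotProduct,
      sumElim_dotProduct_sumElim]
    simp [entApp]
  rw [hgrad, add_zero, one_smul, mulVec_smul, hJv]
  ext i
  rcases i with i | i <;> simp

theorem exists_sum_layers {σ : ℝ → ℝ} {Q : (Fin n → ℝ) → (Fin n → ℝ)}
    (hQ : Q ∈ AddSubmonoid.closure {u | IsLayer σ u}) :
    ∃ (N : ℕ) (u : ℕ → (Fin n → ℝ) → (Fin n → ℝ)), (∀ j, IsLayer σ (u j)) ∧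
      Q = ∑ j ∈ Finset.range N, u j := by
  induction hQ using AddSubmonoid.closure_induction_right with
  | zero => exact ⟨0, fun _ _ => 0, fun _ => ⟨0, 0, 0, 0, by simp, by simp⟩, by simp⟩
  | add_right Q _ v hv ih =>
    obtain ⟨N, u, hu, rfl⟩ := ih
    refine ⟨N + 1, fun j => if j < N then u j else v, fun j => ?_, ?_⟩
    · dsimp only
      split_ifs
      exacts [hu j, hv]
    · rw [Finset.sum_range_succ, if_neg (lt_irrefl N)]
      exact congrArg (· + v) (Finset.sum_congr rfl fun j hj => by
        rw [if_pos (Finset.mem_range.1 hj)])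

theorem exists_hdnn_of_mem_closure {σ : ℝ → ℝ} {Q : (Fin n → ℝ) → (Fin n → ℝ)}
    (hQ : Q ∈ AddSubmonoid.closure {u | IsLayer σ u}) :
    ∃ (N : ℕ) (J W : ℕ → Matrix (Fin n ⊕ Fin n) (Fin n ⊕ Fin n) ℝ)
      (b η : ℕ → ((Fin n ⊕ Fin n) → ℝ)), (∀ j, (J j)ᵀ = -(J j)) ∧
      ∀ ξ, ∃ p q : ℕ → (Fin n → ℝ), IsHDNNTraj n N 1 σ J W b η p q ∧
        p 0 = ξ ∧ q 0 = (fun _ => 0) ∧ q N = Q ξ := by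
  obtain ⟨N, u, hu, rfl⟩ := exists_sum_layers hQ
  choose J W b η hJ h using hu
  refine ⟨N, J, W, b, η, hJ, fun ξ => ⟨fun _ => ξ, fun j => ∑ i ∈ Finset.range j, u i ξ, ?_, rfl,
    by simp; rfl, by simp⟩⟩
  intro j _
  dsimp only
  rw [Finset.sum_range_succ, ← h j]

theorem exists_mem_closure_of_mem_span {σ : C(ℝ, ℝ)} {Ω : Set (Fin n → ℝ)} {v : C(Ω, ℝ)}
    (hv : v ∈ Submodule.span ℝ {g : C(Ω, ℝ) | ∃ (w : Fin n → ℝ) (b : ℝ),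
      ∀ x, g x = σ (w ⬝ᵥ (x : Fin n → ℝ) + b)}) (i : Fin n) :
    ∃ Q ∈ AddSubmonoid.closure {u : (Fin n → ℝ) → (Fin n → ℝ) | IsLayer σ u},
      ∀ x : Ω, Q x = Pi.single i (v x) := by
  induction hv using Submodule.closure_induction with
  | zero => exact ⟨0, zero_mem _, fun x => by simp⟩
  | add v₁ v₂ _ _ h₁ h₂ =>
    obtain ⟨Q₁, hQ₁, e₁⟩ := h₁
    obtain ⟨Q₂, hQ₂, e₂⟩ := h₂
    refine ⟨Q₁ + Q₂, add_mem hQ₁ hQ₂, fun x => ?_⟩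
    rw [Pi.add_apply, e₁, e₂, ContinuousMap.add_apply, Pi.single_add]
  | smul_mem r g hg =>
    obtain ⟨w, b, hg⟩ := hg
    refine ⟨_, AddSubmonoid.subset_closure (isLayer_ridge σ w (Pi.single i r) b), fun x => ?_⟩
    rw [ContinuousMap.smul_apply, hg, ← Pi.single_smul, smul_eq_mul, smul_eq_mul, mul_comm]

end Layers

/-- Shallow networks with a continuous, non-polynomial activation function are dense in `C(Ω, ℝ)`
for `Ω ⊆ ℝⁿ` compact. -/
theorem dense_span_ridge {n : ℕ} {σ : C(ℝ, ℝ)}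
    (hpoly : ¬ ∃ P : Polynomial ℝ, ∀ x, σ x = P.eval x) (Ω : Set (Fin n → ℝ)) [CompactSpace Ω] :
    (Submodule.span ℝ {g : C(Ω, ℝ) | ∃ (w : Fin n → ℝ) (b : ℝ),
      ∀ x, g x = σ (w ⬝ᵥ (x : Fin n → ℝ) + b)}).topologicalClosure = ⊤ := by
  set S := Submodule.span ℝ {g : C(Ω, ℝ) | ∃ (w : Fin n → ℝ) (b : ℝ),
    ∀ x, g x = σ (w ⬝ᵥ (x : Fin n → ℝ) + b)} with hS
  let lin : (Fin n → ℝ) →+ C(Ω, ℝ) :=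
    { toFun := fun w => ⟨fun x => w ⬝ᵥ (x : Fin n → ℝ), Continuous.dotProduct continuous_const continuous_subtype_val⟩
      map_zero' := by ext x; exact zero_dotProduct (x : Fin n → ℝ)
      map_add' := fun w w' => by ext x; exact add_dotProduct w w' (x : Fin n → ℝ) }
  have hcl := S.isClosed_topologicalClosure
  refine eq_top_of_exp_mem hcl lin.range ?_ ?_
  · rintro _ ⟨w, rfl⟩
    refine exp_mem_of_pow_mem hcl (pow_mem_of_ridge_mem hcl hpoly fun t b => ?_)
    refine S.le_topologicalClosure (Submodule.subset_span ⟨t • w, b, fun x => ?_⟩)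
    rw [smul_dotProduct]
    rfl
  · intro x x' hx
    obtain ⟨i, hi⟩ := Function.ne_iff.1 (Subtype.coe_ne_coe.2 hx)
    refine ⟨lin (Pi.single i 1), ⟨_, rfl⟩, ?_⟩
    change Pi.single i 1 ⬝ᵥ (x : Fin n → ℝ) ≠ Pi.single i 1 ⬝ᵥ (x' : Fin n → ℝ)
    simpa using hi

theorem euclNorm_le_of_forall_abs_le {n : ℕ} {v : Fin n → ℝ} {ε : ℝ} (hε : 0 ≤ ε)
    (h : ∀ i, |v i| ≤ ε / (n + 1)) : euclNorm v ≤ ε := by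
  refine Real.sqrt_le_iff.2 ⟨hε, ?_⟩
  calc ∑ i, v i ^ 2 ≤ ∑ _i : Fin n, (ε / (n + 1)) ^ 2 :=
        Finset.sum_le_sum fun i _ => sq_le_sq' (abs_le.1 (h i)).1 (abs_le.1 (h i)).2
    _ = ε ^ 2 * (n / (n + 1) ^ 2) := by
        rw [Finset.sum_const, Finset.card_univ, Fintype.card_fin, nsmul_eq_mul, div_pow]
        ring
    _ ≤ ε ^ 2 * 1 := by
        gcongr
        rw [div_le_one (by positivity)]
        nlinarith [(Nat.cast_nonneg n : (0 : ℝ) ≤ n)]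
    _ = ε ^ 2 := mul_one _

/-- Universal approximation property of the restricted flow `ξ ↦ q_N` of an HDNN. -/
theorem hdnn_restricted_flow_UAP {n : ℕ} (σ : ℝ → ℝ)
    (hσLip : ∃ K : NNReal, LipschitzWith K σ)
    (hσpoly : ¬ ∃ P : Polynomial ℝ, ∀ x : ℝ, σ x = P.eval x)
    (Ω : Set (Fin n → ℝ)) (hΩ : IsCompact Ω)
    (f : (Fin n → ℝ) → (Fin n → ℝ)) (hf : ContinuousOn f Ω)
    (ε : ℝ) (hε : 0 < ε) :
    ∃ (N : ℕ) (h : ℝ) (J W : ℕ → Matrix (Fin n ⊕ Fin n) (Fin n ⊕ Fin n) ℝ)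
      (b η : ℕ → ((Fin n ⊕ Fin n) → ℝ)) (Q : (Fin n → ℝ) → (Fin n → ℝ)),
      0 < h ∧
      (∀ j < N, (J j)ᵀ = -(J j)) ∧
      (∀ ξ ∈ Ω, ∃ p q : ℕ → (Fin n → ℝ),
        IsHDNNTraj n N h σ J W b η p q ∧
        p 0 = ξ ∧ q 0 = (fun _ => 0) ∧ q N = Q ξ) ∧
      (∀ ξ ∈ Ω, euclNorm (f ξ - Q ξ) ≤ ε) := by
  obtain ⟨K, hK⟩ := hσLip
  let τ : C(ℝ, ℝ) := ⟨σ, hK.continuous⟩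
  have : CompactSpace Ω := isCompact_iff_compactSpace.1 hΩ
  let F : Fin n → C(Ω, ℝ) := fun i =>
    ⟨fun x => f x i, (continuous_apply i).comp hf.domRestrict⟩
  have happ : ∀ i, ∃ Q ∈ AddSubmonoid.closure {u : (Fin n → ℝ) → (Fin n → ℝ) | IsLayer σ u},
      ∃ v : C(Ω, ℝ), (∀ x : Ω, Q x = Pi.single i (v x)) ∧ dist (F i) v < ε / (n + 1) := by
    intro i
    have hmem : F i ∈ closure (Submodule.span ℝ {g : C(Ω, ℝ) | ∃ (w : Fin n → ℝ) (b : ℝ),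
        ∀ x, g x = τ (w ⬝ᵥ (x : Fin n → ℝ) + b)} : Set C(Ω, ℝ)) := by
      rw [← Submodule.topologicalClosure_coe, dense_span_ridge hσpoly]
      trivial
    obtain ⟨v, hv, hd⟩ := Metric.mem_closure_iff.1 hmem (ε / (n + 1)) (by positivity)
    obtain ⟨Q, hQ, hQv⟩ := exists_mem_closure_of_mem_span hv i
    exact ⟨Q, hQ, v, hQv, hd⟩
  choose Q hQ v hQv hd using happ
  obtain ⟨N, J, W, b, η, hJ, htraj⟩ := exists_hdnn_of_mem_closure
    (AddSubmonoid.sum_mem _ fun i (_ : i ∈ Finset.univ) => hQ i)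
  refine ⟨N, 1, J, W, b, η, _, one_pos, fun j _ => hJ j, fun ξ _ => htraj ξ, fun ξ hξ => ?_⟩
  refine euclNorm_le_of_forall_abs_le hε.le fun i => ?_
  have hsum : (∑ k, Q k) ξ i = v i ⟨ξ, hξ⟩ := by
    rw [Finset.sum_apply, Finset.sum_apply, Finset.sum_congr rfl fun k _ =>
      congrFun (hQv k ⟨ξ, hξ⟩) i]
    simp [Pi.single_apply]
  rw [Pi.sub_apply, hsum]
  exact (ContinuousMap.dist_apply_le_dist (f := F i) (g := v i) ⟨ξ, hξ⟩).trans (hd i).le
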